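/- arXiv:1804.08252 — 2 statements merged into one kernel-verified Lean document; each statement's English description precedes it below -/
import Mathlib

section
/- M(46, 39) ≥ 551040: there exists a set of 551040 permutations of Z_46 whose pairwise Hamming distance is at least 39. -/
open Polynomial in
/-- A nonzero polynomial of degree at most `n` has at most `n` zeros on the projective line, where
the point at infinity counts as a zero when the coefficient of degree `n` vanishes. -/
theorem card_le_of_projective_roots {F : Type*} [Field F] [DecidableEq F] {p : F[X]} {n : ℕ}
    (hp : p ≠ 0) (hn : p.natDegree ≤ n) (s : Finset (Option F))
    (hs : ∀ x, some x ∈ s → p.eval x = 0) (hinf : none ∈ s → p.coeff n = 0) : s.card ≤ n := by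
  have hroots : s.eraseNone.card ≤ p.natDegree := by
    refine (Finset.card_le_card (t := p.roots.toFinset) fun x hx => ?_).trans
      ((Multiset.toFinset_card_le _).trans p.card_roots')
    rw [Multiset.mem_toFinset, mem_roots hp]
    exact hs x (Finset.mem_eraseNone.mp hx)
  rw [Finset.card_eraseNone_eq_card_erase] at hroots
  by_cases h : none ∈ s
  · rw [Finset.card_erase_of_mem h] at hroots
    have hlt : p.natDegree ≠ n := fun he => by
      have := hinf h
      rw [← he] at this
      exact hp (leadingCoeff_eq_zero.mp this)
    omega
  · rw [Finset.erase_eq_of_notMem h] at hroots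
    omega

namespace ProjectiveLine

variable {F : Type*} [Field F]

/-- The first homogeneous coordinate of a point of the projective line. -/
def fst : Option F → F
  | none => 1
  | some x => x

/-- The second homogeneous coordinate of a point of the projective line. -/
def snd : Option F → F
  | none => 0
  | some _ => 1

/-- Normal forms of the invertible matrices up to scalars: `x ↦ a * x + b` and
`x ↦ b + a / (x + d)`. -/
def normalForm : Option F × F × Fˣ → Matrix (Fin 2) (Fin 2) F
  | (none, b, a) => !![(a : F), b; 0, 1]
  | (some d, b, a) => !![b, b * d + a; 1, d]

theorem det_normalForm_ne_zero (t : Option F × F × Fˣ) : (normalForm t).det ≠ 0 := by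
  obtain ⟨_ | d, b, a⟩ := t <;> simp [normalForm, Matrix.det_fin_two]

theorem normalForm_proportional {t u : Option F × F × Fˣ}
    (h₂ : normalForm t 0 0 * normalForm u 1 0 = normalForm u 0 0 * normalForm t 1 0)
    (h₁ : normalForm t 0 0 * normalForm u 1 1 + normalForm t 0 1 * normalForm u 1 0 =
      normalForm u 0 0 * normalForm t 1 1 + normalForm u 0 1 * normalForm t 1 0)
    (h₀ : normalForm t 0 1 * normalForm u 1 1 = normalForm u 0 1 * normalForm t 1 1) :
    t = u := by
  obtain ⟨_ | d, b, a⟩ := t <;> obtain ⟨_ | d', b', a'⟩ := u <;> simp [normalForm] at h₀ h₁ h₂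
  · simp [h₀, Units.ext h₁]
  · exact absurd h₂.symm a'.ne_zero
  · subst h₂
    have ha : a = a' := Units.ext (by linear_combination h₁)
    subst ha
    have hd : d = d' := mul_left_cancel₀ a.ne_zero (by linear_combination -h₀)
    rw [hd]

variable [DecidableEq F]

/-- The fractional linear map with matrix `M`. -/
def mobius (M : Matrix (Fin 2) (Fin 2) F) (p : Option F) : Option F :=
  if M 1 0 * fst p + M 1 1 * snd p = 0 then none
  else some ((M 0 0 * fst p + M 0 1 * snd p) / (M 1 0 * fst p + M 1 1 * snd p))

theorem cross_mul_eq_of_mobius_eq {M N : Matrix (Fin 2) (Fin 2) F} {p q : Option F}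
    (h : mobius M p = mobius N q) :
    (M 0 0 * fst p + M 0 1 * snd p) * (N 1 0 * fst q + N 1 1 * snd q) =
      (N 0 0 * fst q + N 0 1 * snd q) * (M 1 0 * fst p + M 1 1 * snd p) := by
  unfold mobius at h
  split_ifs at h with h₁ h₂ h₂
  · rw [h₁, h₂, mul_zero, mul_zero]
  · exact (div_eq_div_iff h₁ h₂).mp (Option.some.inj h)

theorem mobius_injective {M : Matrix (Fin 2) (Fin 2) F} (hM : M.det ≠ 0) :
    Function.Injective (mobius M) := by
  intro p q h
  have h' := cross_mul_eq_of_mobius_eq h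
  rw [Matrix.det_fin_two] at hM
  have key : fst p * snd q = fst q * snd p := mul_left_cancel₀ hM (by linear_combination h')
  cases p <;> cases q <;> simp_all [fst, snd]

/-- An invertible fractional linear map of a finite projective line, as a permutation. -/
noncomputable def mobiusPerm [Finite F] (M : Matrix (Fin 2) (Fin 2) F) (hM : M.det ≠ 0) :
    Equiv.Perm (Option F) :=
  Equiv.ofBijective (mobius M) (Finite.injective_iff_bijective.mp (mobius_injective hM))

open Polynomial in
theorem card_mobius_eq_mobius_le_two [Fintype F] {t u : Option F × F × Fˣ} (htu : t ≠ u) :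
    (Finset.univ.filter fun p => mobius (normalForm t) p = mobius (normalForm u) p).card ≤ 2 := by
  set M := normalForm t
  set N := normalForm u
  refine card_le_of_projective_roots
    (p := C (M 0 0 * N 1 0 - N 0 0 * M 1 0) * X ^ 2 +
      C (M 0 0 * N 1 1 + M 0 1 * N 1 0 - (N 0 0 * M 1 1 + N 0 1 * M 1 0)) * X +
      C (M 0 1 * N 1 1 - N 0 1 * M 1 1)) (fun h => htu ?_) natDegree_quadratic_le _ ?_ ?_
  · have h₂ := congrArg (coeff · 2) h
    have h₁ := congrArg (coeff · 1) h
    have h₀ := congrArg (coeff · 0) h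
    simp only [coeff_add, coeff_C_mul, coeff_X_pow, coeff_X, coeff_C, coeff_zero] at h₀ h₁ h₂
    norm_num at h₀ h₁ h₂
    exact normalForm_proportional (by linear_combination h₂) (by linear_combination h₁)
      (by linear_combination h₀)
  · intro x hx
    have h := cross_mul_eq_of_mobius_eq (Finset.mem_filter.mp hx).2
    simp only [fst, snd] at h
    simp only [eval_add, eval_mul, eval_C, eval_pow, eval_X]
    linear_combination h
  · intro hx
    have h := cross_mul_eq_of_mobius_eq (Finset.mem_filter.mp hx).2
    simp only [fst, snd] at h
    simp only [coeff_add, coeff_C_mul, coeff_X_pow, coeff_X, coeff_C]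
    norm_num
    linear_combination h

open Polynomial in
theorem card_mobius_cube_eq_le_six [Fintype F] (h3 : (3 : F) ≠ 0)
    {M N : Matrix (Fin 2) (Fin 2) F} (hM : M.det ≠ 0) (hN : N.det ≠ 0) {i j : F} (hij : i ≠ j) :
    (Finset.univ.filter fun p : Option F =>
      mobius M (p.map fun x => (x + i) ^ 3) = mobius N (p.map fun x => (x + j) ^ 3)).card ≤ 6 := by
  rw [Matrix.det_fin_two] at hM hN
  set a := M 0 0 * N 1 0 - N 0 0 * M 1 0 with ha
  set b := M 0 0 * N 1 1 - N 0 1 * M 1 0 with hb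
  set c := M 0 1 * N 1 0 - N 0 0 * M 1 1 with hc
  set d := M 0 1 * N 1 1 - N 0 1 * M 1 1 with hd
  have hdet : a * d - b * c ≠ 0 := by
    have : a * d - b * c =
        (M 0 0 * M 1 1 - M 0 1 * M 1 0) * (N 0 0 * N 1 1 - N 0 1 * N 1 0) := by
      rw [ha, hb, hc, hd]; ring
    rw [this]
    exact mul_ne_zero hM hN
  have hcoeff : (C a * ((X + C i) ^ 3 * (X + C j) ^ 3) + C b * (X + C i) ^ 3 +
      C c * (X + C j) ^ 3 + C d).coeff 6 = a := by
    have e : C a * ((X + C i) ^ 3 * (X + C j) ^ 3) + C b * (X + C i) ^ 3 +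
      C c * (X + C j) ^ 3 + C d = C a * ((X + C i) ^ 3 * (X + C j) ^ 3) + (C b * (X + C i) ^ 3 +
      C c * (X + C j) ^ 3 + C d) := by ring
    have m : ((X + C i) ^ 3 * (X + C j) ^ 3 : F[X]).Monic :=
      ((monic_X_add_C i).pow 3).mul ((monic_X_add_C j).pow 3)
    have nd : ((X + C i) ^ 3 * (X + C j) ^ 3 : F[X]).natDegree = 6 := by
      rw [((monic_X_add_C i).pow 3).natDegree_mul ((monic_X_add_C j).pow 3)]; simp
    have h6 : ((X + C i) ^ 3 * (X + C j) ^ 3 : F[X]).coeff 6 = 1 := by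
      rw [← nd]; exact m
    have hl : (C b * (X + C i) ^ 3 + C c * (X + C j) ^ 3 + C d).natDegree ≤ 3 := by
      compute_degree
    rw [e, coeff_add, coeff_C_mul, h6, coeff_eq_zero_of_natDegree_lt (by omega)]
    ring
  refine card_le_of_projective_roots
    (p := C a * ((X + C i) ^ 3 * (X + C j) ^ 3) + C b * (X + C i) ^ 3 +
      C c * (X + C j) ^ 3 + C d) (fun h => hdet ?_) (by compute_degree) _ ?_ ?_
  · have ha0 : a = 0 := by rw [← hcoeff, h, coeff_zero]
    have hshift := congrArg (fun p : F[X] => p.comp (X - C i)) h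
    have hexp : C b * X ^ 3 + C c * (X ^ 3 + C (3 * (j - i)) * X ^ 2 +
        C (3 * (j - i) ^ 2) * X + C ((j - i) ^ 3)) + C d = 0 := by
      simp only [ha0, add_comp, mul_comp, pow_comp, X_comp, C_comp, zero_comp] at hshift
      rw [← hshift]
      simp only [C_mul, C_pow, C_sub, map_ofNat, C_0]
      ring
    have hc2 := congrArg (coeff · 2) hexp
    simp only [coeff_add, coeff_C_mul, coeff_X_pow, coeff_X, coeff_C, coeff_zero] at hc2
    norm_num at hc2
    have hc0 : c = 0 := by
      rcases hc2 with h | h | h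
      · exact h
      · exact absurd h h3
      · exact absurd (sub_eq_zero.mp h).symm hij
    rw [ha0, hc0]; ring
  · intro x hx
    have h := cross_mul_eq_of_mobius_eq (Finset.mem_filter.mp hx).2
    simp only [fst, snd, Option.map_some] at h
    simp only [eval_add, eval_mul, eval_C, eval_pow, eval_X]
    linear_combination h
  · intro hx
    have h := cross_mul_eq_of_mobius_eq (Finset.mem_filter.mp hx).2
    simp only [fst, snd, Option.map_none] at h
    rw [hcoeff]
    linear_combination h

end ProjectiveLine

instance : Fact (Nat.Prime 41) := ⟨by norm_num⟩

theorem cube_bijective_zmod_41 : Function.Bijective fun x : ZMod 41 => x ^ 3 := by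
  refine Finite.injective_iff_bijective.mp
    (Function.LeftInverse.injective (g := fun y => y ^ 27) fun x => ?_)
  have h := ZMod.pow_card x
  calc (x ^ 3) ^ 27 = x ^ 41 * x ^ 40 := by ring
    _ = x * x ^ 40 := by rw [h]
    _ = x ^ 41 := by ring
    _ = x := h

/-- The permutation `x ↦ (x + i) ^ 3` of the projective line over `ZMod 41`. -/
noncomputable def shiftedCube (i : ZMod 41) : Equiv.Perm (Option (ZMod 41)) :=
  Equiv.optionCongr ((Equiv.addRight i).trans (Equiv.ofBijective _ cube_bijective_zmod_41))

theorem shiftedCube_apply (i : ZMod 41) (p : Option (ZMod 41)) :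
    shiftedCube i p = p.map fun x => (x + i) ^ 3 := by
  cases p <;> rfl

/-- Eight even permutations of four points. -/
def evenPerm : Fin 8 → Equiv.Perm (Fin 4) :=
  ![1, .swap 0 1 * .swap 2 3, .swap 0 2 * .swap 1 3, .swap 0 3 * .swap 1 2,
    .swap 0 1 * .swap 1 2, .swap 0 1 * .swap 0 2, .swap 0 1 * .swap 1 3, .swap 0 1 * .swap 0 3]

theorem card_evenPerm_eq_le_one {k l : Fin 8} (h : k ≠ l) :
    (Finset.univ.filter fun x => evenPerm k x = evenPerm l x).card ≤ 1 := by
  revert k l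
  decide

open ProjectiveLine

/-- The permutation of the projective line over `ZMod 41` extended by four points which is
`M ∘ (x ↦ (x + k) ^ 3)` on the line, with `M` fractional linear, and even on the extra points. -/
noncomputable def extendedPerm (t : (Option (ZMod 41) × ZMod 41 × (ZMod 41)ˣ) × Fin 8) :
    Equiv.Perm (Option (ZMod 41) ⊕ Fin 4) :=
  Equiv.sumCongr
    ((shiftedCube (t.2.val : ZMod 41)).trans (mobiusPerm _ (det_normalForm_ne_zero t.1)))
    (evenPerm t.2)

theorem card_sumCongr_eq {α β : Type*} [Fintype α] [Fintype β] [DecidableEq α] [DecidableEq β]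
    (f f' : Equiv.Perm α) (g g' : Equiv.Perm β) :
    (Finset.univ.filter fun x => Equiv.sumCongr f g x = Equiv.sumCongr f' g' x).card =
      (Finset.univ.filter fun x => f x = f' x).card +
      (Finset.univ.filter fun x => g x = g' x).card := by
  simp only [Finset.card_filter, Fintype.sum_sum_type, Equiv.sumCongr_apply, Sum.map_inl,
    Sum.map_inr, Sum.inl.injEq, Sum.inr.injEq]

theorem card_extendedPerm_eq_le_seven
    {t u : (Option (ZMod 41) × ZMod 41 × (ZMod 41)ˣ) × Fin 8} (h : t ≠ u) :
    (Finset.univ.filter fun x => extendedPerm t x = extendedPerm u x).card ≤ 7 := by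
  obtain ⟨t, k⟩ := t
  obtain ⟨u, l⟩ := u
  unfold extendedPerm
  rw [card_sumCongr_eq]
  by_cases hkl : k = l
  · subst hkl
    have htu : t ≠ u := fun e => h (by rw [e])
    have h₁ := card_mobius_eq_mobius_le_two htu
    have h₂ : (Finset.univ.filter fun x => evenPerm k x = evenPerm k x).card ≤ 4 :=
      Finset.card_filter_le _ _
    refine (Nat.add_le_add ((Finset.card_le_card_of_injOn (shiftedCube (k.val : ZMod 41))
      (fun p hp => ?_) (Equiv.injective _).injOn).trans h₁) h₂).trans (by norm_num)
    simpa [mobiusPerm] using hp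
  · have hval : (k.val : ZMod 41) ≠ (l.val : ZMod 41) := by
      clear h
      revert k l
      decide
    have h₁ := card_mobius_cube_eq_le_six (by decide) (det_normalForm_ne_zero t)
      (det_normalForm_ne_zero u) hval
    refine Nat.add_le_add (le_of_eq_of_le ?_ h₁) (card_evenPerm_eq_le_one hkl)
    simp [mobiusPerm, shiftedCube_apply]

theorem card_eq_add_hammingDist {ι β : Type*} [Fintype ι] [DecidableEq β] (f g : ι → β) :
    (Finset.univ.filter fun x => f x = g x).card + hammingDist f g = Fintype.card ι :=
  Finset.card_filter_add_card_filter_not (fun x => f x = g x)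

/-- A family of permutations with pairwise Hamming distances at least `d` gives a set of
permutations of the same cardinality. -/
theorem exists_finset_perm_of_family {ι α : Type*} [Fintype ι] [Fintype α] [DecidableEq α]
    {d : ℕ} (hd : 0 < d) (f : ι → Equiv.Perm α)
    (hf : ∀ t u, t ≠ u → d ≤ hammingDist ⇑(f t) ⇑(f u)) :
    ∃ S : Finset (Equiv.Perm α), S.card = Fintype.card ι ∧
      ∀ σ ∈ S, ∀ τ ∈ S, σ ≠ τ → d ≤ hammingDist ⇑σ ⇑τ := by
  have hinj : Function.Injective f := by
    intro t u htu
    by_contra hne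
    have := hf t u hne
    rw [htu, hammingDist_self] at this
    omega
  refine ⟨Finset.univ.image f, Finset.card_image_of_injective _ hinj, fun σ hσ τ hτ hne => ?_⟩
  obtain ⟨t, -, rfl⟩ := Finset.mem_image.mp hσ
  obtain ⟨u, -, rfl⟩ := Finset.mem_image.mp hτ
  exact hf t u fun h => hne (by rw [h])

/-- `M(46, 39) ≥ 551040`: there exists a set of 551040 permutations of `Z_46` whose pairwise
Hamming distance is at least 39. -/
theorem M_46_39_ge_551040 :
    ∃ S : Finset (Equiv.Perm (Fin 46)), S.card = 551040 ∧
      ∀ σ ∈ S, ∀ τ ∈ S, σ ≠ τ → 39 ≤ hammingDist ⇑σ ⇑τ := by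
  have hcard : Fintype.card (Option (ZMod 41) ⊕ Fin 4) = 46 := by simp [ZMod.card]
  have hindex : Fintype.card ((Option (ZMod 41) × ZMod 41 × (ZMod 41)ˣ) × Fin 8) = 551040 := by
    simp only [Fintype.card_prod, Fintype.card_option, ZMod.card, ZMod.card_units, Fintype.card_fin]
  let e : Option (ZMod 41) ⊕ Fin 4 ≃ Fin 46 := Fintype.equivFinOfCardEq hcard
  rw [← hindex]
  refine exists_finset_perm_of_family (by norm_num) (fun t => e.permCongr (extendedPerm t))
    fun t u htu => ?_
  have hle : (Finset.univ.filter fun x =>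
      e.permCongr (extendedPerm t) x = e.permCongr (extendedPerm u) x).card ≤ 7 := by
    refine (Finset.card_le_card_of_injOn e.symm (fun x hx => ?_) e.symm.injective.injOn).trans
      (card_extendedPerm_eq_le_seven htu)
    simpa [Equiv.permCongr_apply] using hx
  have := card_eq_add_hammingDist ⇑(e.permCongr (extendedPerm t)) ⇑(e.permCongr (extendedPerm u))
  rw [Fintype.card_fin] at this
  omega
end

section
/- M(576, 575) ≥ 12650: there exists a set of 12650 permutations of Z_576 whose pairwise Hamming distance is at least 575. -/
namespace PermutationCode

/-- The permutations `σ` and `τ` agree in at most one point. -/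
def AgreeAtMostOnce {X : Type*} (σ τ : Equiv.Perm X) : Prop :=
  ∀ ⦃x y⦄, σ x = τ x → σ y = τ y → x = y

theorem AgreeAtMostOnce.permCongr {X Y : Type*} {σ τ : Equiv.Perm X}
    (h : AgreeAtMostOnce σ τ) (e : X ≃ Y) :
    AgreeAtMostOnce (e.permCongr σ) (e.permCongr τ) := by
  intro x y hx hy
  simp only [Equiv.permCongr_apply, e.apply_eq_iff_eq] at hx hy
  exact e.symm.injective (h hx hy)

theorem AgreeAtMostOnce.card_le_hammingDist_add_one {X : Type*} [Fintype X] [DecidableEq X]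
    {σ τ : Equiv.Perm X} (h : AgreeAtMostOnce σ τ) :
    Fintype.card X ≤ hammingDist σ τ + 1 := by
  have h1 : (Finset.univ.filter fun x => σ x = τ x).card ≤ 1 := by
    rw [Finset.card_le_one]
    intro x hx y hy
    exact h (Finset.mem_filter.1 hx).2 (Finset.mem_filter.1 hy).2
  have h2 := Finset.card_filter_add_card_filter_not (s := Finset.univ) (fun x => σ x = τ x)
  rw [Finset.card_univ] at h2
  have h3 : hammingDist σ τ = (Finset.univ.filter fun x => ¬ σ x = τ x).card := rfl
  omega

section Extend

variable {X : Type*} [DecidableEq X]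

/-- Extend `φ` to one more point: the new symbol is placed at position `p`, and the displaced
symbol `φ p` at the new position. -/
def extend (φ : Equiv.Perm X) (p : X) : Equiv.Perm (Option X) :=
  (Equiv.swap none (some p)).trans φ.optionCongr

theorem extend_none (φ : Equiv.Perm X) (p : X) : extend φ p none = some (φ p) := by
  simp [extend]

theorem extend_some (φ : Equiv.Perm X) (p x : X) :
    extend φ p (some x) = if x = p then none else some (φ x) := by
  by_cases h : x = p
  · simp [extend, h]
  · simp [extend, h, Equiv.swap_apply_of_ne_of_ne]

theorem agreeAtMostOnce_extend_of_ne {φ ψ : Equiv.Perm X} {p q : X}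
    (h : AgreeAtMostOnce φ ψ) (hpq : p ≠ q) (hv : φ p ≠ ψ q) :
    AgreeAtMostOnce (extend φ p) (extend ψ q) := by
  have key : ∀ z, extend φ p z = extend ψ q z → ∃ x, z = some x ∧ φ x = ψ x := by
    rintro (_ | x) hz
    · rw [extend_none, extend_none] at hz
      exact absurd (Option.some.inj hz) hv
    · rw [extend_some, extend_some] at hz
      refine ⟨x, rfl, ?_⟩
      split_ifs at hz with h1 h2
      · exact absurd (h1.symm.trans h2) hpq
      · exact Option.some.inj hz
  intro x y hx hy
  obtain ⟨x, rfl, hx'⟩ := key x hx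
  obtain ⟨y, rfl, hy'⟩ := key y hy
  exact congrArg some (h hx' hy')

theorem agreeAtMostOnce_extend_of_forall_ne {φ ψ : Equiv.Perm X} {p q : X}
    (h : ∀ x, φ x ≠ ψ x) : AgreeAtMostOnce (extend φ p) (extend ψ q) := by
  have key : ∀ z, extend φ p z = extend ψ q z → z = none ∧ φ p = ψ q ∨ z = some p ∧ p = q := by
    rintro (_ | x) hz
    · rw [extend_none, extend_none] at hz
      exact Or.inl ⟨rfl, Option.some.inj hz⟩
    · rw [extend_some, extend_some] at hz
      split_ifs at hz with h1 h2
      · exact Or.inr ⟨by rw [h1], h1.symm.trans h2⟩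
      · exact absurd (Option.some.inj hz) (h x)
  intro x y hx hy
  rcases key x hx with ⟨rfl, h1⟩ | ⟨rfl, h1⟩ <;> rcases key y hy with ⟨rfl, h2⟩ | ⟨rfl, h2⟩
  · rfl
  · exact absurd (h2 ▸ h1) (h q)
  · exact absurd (h1 ▸ h2) (h q)
  · rfl

end Extend

section Affine

/-- The affine permutation `x ↦ a * x + b` of a field. -/
def affine {F : Type*} [Field F] (a : Fˣ) (b : F) : Equiv.Perm F :=
  a.mulLeft.trans (Equiv.addRight b)

theorem affine_apply {F : Type*} [Field F] (a : Fˣ) (b x : F) : affine a b x = a * x + b := rfl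

theorem affine_agree {F : Type*} [Field F] {a a' : Fˣ} (h : a ≠ a') {b b' x y : F}
    (hx : affine a b x = affine a' b' x) (hy : affine a b y = affine a' b' y) : x = y := by
  simp only [affine_apply] at hx hy
  have h1 : (a - a' : F) ≠ 0 := sub_ne_zero.2 fun e => h (Units.ext e)
  refine mul_left_cancel₀ h1 ?_
  linear_combination hx - hy

variable {A B : Type*} [Field A] [Field B] [DecidableEq A] [DecidableEq B]

/-- The affine permutations of `A × B` with linear part `(a, ι a)`, extended by a point. In the
block of `a`, the new symbol is placed on a position in `A × {ι a}` whose symbol lies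
in `{a} × B`. -/
def codeword (ι : Aˣ ↪ Bˣ) (i : Aˣ × A × B) : Equiv.Perm (Option (A × B)) :=
  extend ((affine i.1 i.2.1).prodCongr (affine (ι i.1) i.2.2))
    ((affine i.1 i.2.1).symm i.1, (ι i.1 : B))

theorem agreeAtMostOnce_codeword (ι : Aˣ ↪ Bˣ) {i j : Aˣ × A × B} (hij : i ≠ j) :
    AgreeAtMostOnce (codeword ι i) (codeword ι j) := by
  obtain ⟨a, b, c⟩ := i
  obtain ⟨a', b', c'⟩ := j
  by_cases h : a = a'
  · subst h
    refine agreeAtMostOnce_extend_of_forall_ne ?_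
    rintro ⟨x, y⟩ hxy
    simp only [Equiv.prodCongr_apply, Prod.map_apply, Prod.mk.injEq, affine_apply,
      add_right_inj] at hxy
    exact hij (by rw [hxy.1, hxy.2])
  · have hι : ι a ≠ ι a' := fun e => h (ι.injective e)
    refine agreeAtMostOnce_extend_of_ne ?_ ?_ ?_
    · rintro ⟨x, y⟩ ⟨x', y'⟩ h1 h2
      simp only [Equiv.prodCongr_apply, Prod.map_apply, Prod.mk.injEq] at h1 h2
      exact Prod.ext (affine_agree h h1.1 h2.1) (affine_agree hι h1.2 h2.2)
    · exact fun e => hι (Units.ext (Prod.mk.inj e).2)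
    · intro e
      simp only [Equiv.prodCongr_apply, Prod.map_apply, Equiv.apply_symm_apply,
        Prod.mk.injEq] at e
      exact h (Units.ext e.1)

end Affine

/-- For finite fields `A`, `B` with `|A| ≤ |B|` and `n = |A| |B| + 1`,
one has `M(n, n - 1) ≥ (|A| - 1) |A| |B|`. -/
theorem exists_code (A B : Type*) [Field A] [Field B] [Fintype A] [Fintype B]
    (hAB : Fintype.card A ≤ Fintype.card B) {n : ℕ}
    (hn : n = Fintype.card A * Fintype.card B + 1) :
    ∃ S : Finset (Equiv.Perm (Fin n)),
      S.card = (Fintype.card A - 1) * (Fintype.card A * Fintype.card B) ∧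
      ∀ σ ∈ S, ∀ τ ∈ S, σ ≠ τ → n - 1 ≤ hammingDist ⇑σ ⇑τ := by
  classical
  obtain ⟨ι⟩ : Nonempty (Aˣ ↪ Bˣ) := by
    rw [Function.Embedding.nonempty_iff_card_le, Fintype.card_units, Fintype.card_units]
    omega
  let e : Option (A × B) ≃ Fin n := Fintype.equivFinOfCardEq (by simp [hn])
  let f : Aˣ × A × B → Equiv.Perm (Fin n) := fun i => e.permCongr (codeword ι i)
  have hd : ∀ i j, i ≠ j → n - 1 ≤ hammingDist (f i) (f j) := fun i j hij => by
    have := ((agreeAtMostOnce_codeword ι hij).permCongr e).card_le_hammingDist_add_one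
    rw [Fintype.card_fin] at this
    exact Nat.sub_le_of_le_add this
  have hf : Function.Injective f := by
    intro i j h
    by_contra hij
    have h1 := hd i j hij
    rw [h, hammingDist_self] at h1
    have h2 : 0 < Fintype.card A * Fintype.card B := Nat.mul_pos Fintype.card_pos Fintype.card_pos
    omega
  refine ⟨Finset.univ.image f, ?_, ?_⟩
  · rw [Finset.card_image_of_injective _ hf, Finset.card_univ, Fintype.card_prod,
      Fintype.card_prod, Fintype.card_units]
  · intro σ hσ τ hτ hne
    obtain ⟨i, -, rfl⟩ := Finset.mem_image.1 hσ
    obtain ⟨j, -, rfl⟩ := Finset.mem_image.1 hτ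
    exact hd i j fun h => hne (congrArg f h)

end PermutationCode

/-- `M(576, 575) ≥ 12650`: there exists a set of 12650 permutations of `Z_576` whose pairwise
Hamming distance is at least 575. -/
theorem M_576_575_ge_12650 :
    ∃ S : Finset (Equiv.Perm (Fin 576)), S.card = 12650 ∧
      ∀ σ ∈ S, ∀ τ ∈ S, σ ≠ τ → 575 ≤ hammingDist ⇑σ ⇑τ := by
  have : Fact (Nat.Prime 23) := ⟨by norm_num⟩
  have : Fact (Nat.Prime 5) := ⟨by norm_num⟩
  let _ : Fintype (GaloisField 5 2) := Fintype.ofFinite _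
  have hA : Fintype.card (ZMod 23) = 23 := ZMod.card 23
  have hB : Fintype.card (GaloisField 5 2) = 25 := by
    rw [← Nat.card_eq_fintype_card, GaloisField.card 5 2 two_ne_zero]
    norm_num
  obtain ⟨S, hS, hd⟩ := PermutationCode.exists_code (ZMod 23) (GaloisField 5 2) (n := 576)
    (by rw [hA, hB]; norm_num) (by rw [hA, hB])
  exact ⟨S, by rw [hS, hA, hB], hd⟩
end
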